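/- Let χ be a finite alphabet, P = [p_{ij}] an irreducible and aperiodic stochastic matrix on χ with stationary distribution π_μ, μ the stationary Markov measure on χ^ℕ, and suppose the Rényi entropy H₂(μ) exists (the limit defining it exists and equals h). Then for every Markov measure ν with arbitrary initial distribution π and transition matrix P, the lower Rényi entropy satisfies H̲₂(ν) ≥ h. -/

import Mathlib

open MeasureTheory Filter

/-- The sum over all `k`-cylinders of the squared measure of the cylinder. -/
noncomputable def renyiSum {χ : Type*} [Fintype χ] [MeasurableSpace χ]
    (Q : Measure (ℕ → χ)) (k : ℕ) : ℝ :=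
  ∑ w : Fin k → χ, ((Q {z | ∀ i : Fin k, z (i : ℕ) = w i}).toReal) ^ 2

/-- Lower Rényi entropy `H̲₂(Q) = -liminf (1/k) log ∑_{C_k} Q(C_k)²`. -/
noncomputable def lowerRenyi {χ : Type*} [Fintype χ] [MeasurableSpace χ]
    (Q : Measure (ℕ → χ)) : ℝ :=
  -Filter.liminf (fun k : ℕ => (1 / (k : ℝ)) * Real.log (renyiSum Q k)) Filter.atTop

/-- Upper Rényi entropy `H̄₂(Q) = -limsup (1/k) log ∑_{C_k} Q(C_k)²`. -/
noncomputable def upperRenyi {χ : Type*} [Fintype χ] [MeasurableSpace χ]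
    (Q : Measure (ℕ → χ)) : ℝ :=
  -Filter.limsup (fun k : ℕ => (1 / (k : ℝ)) * Real.log (renyiSum Q k)) Filter.atTop

/-- `ν` is the Markov measure with initial distribution `π` and transition matrix `P`:
every `(n+1)`-cylinder `[w₀ … w_n]` has mass `π(w₀) ∏ P(wᵢ, wᵢ₊₁)`. -/
def IsMarkovMeasure {χ : Type*} [Fintype χ] [MeasurableSpace χ]
    (ν : Measure (ℕ → χ)) (π : χ → ℝ) (P : Matrix χ χ ℝ) : Prop :=
  ∀ (n : ℕ) (w : ℕ → χ),
    (ν {z | ∀ i ≤ n, z i = w i}).toReal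
      = π (w 0) * ∏ i ∈ Finset.range n, P (w i) (w (i + 1))

/-- A stationary distribution of a primitive stochastic matrix charges every state. -/
theorem stationary_pos_of_primitive {χ : Type*} [Fintype χ] [DecidableEq χ]
    {P : Matrix χ χ ℝ} (hprim : ∃ n : ℕ, 0 < n ∧ ∀ i j, 0 < (P ^ n) i j)
    {p : χ → ℝ} (hpnn : ∀ i, 0 ≤ p i) (hpsum : ∑ i, p i = 1)
    (hstat : ∀ j, ∑ i, p i * P i j = p j) (j : χ) : 0 < p j := by
  obtain ⟨n, -, hn⟩ := hprim
  have hP : Matrix.vecMul p P = p := funext hstat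
  have hpow : ∀ m : ℕ, Matrix.vecMul p (P ^ m) = p := by
    intro m
    induction m with
    | zero => simp
    | succ m ih => rw [pow_succ, ← Matrix.vecMul_vecMul, ih, hP]
  have hj : ∑ i, p i * (P ^ n) i j = p j := congrFun (hpow n) j
  rw [← hj]
  obtain ⟨i, -, hi⟩ : ∃ i ∈ Finset.univ, 0 < p i := by
    by_contra! hle
    have := Finset.sum_nonpos hle
    linarith
  exact Finset.sum_pos' (fun i _ => mul_nonneg (hpnn i) (hn i j).le)
    ⟨i, Finset.mem_univ i, mul_pos hi (hn i j)⟩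

/-- The mass a Markov measure gives to a nonempty cylinder, indexed by finite words. -/
theorem IsMarkovMeasure.toReal_cylinder {χ : Type*} [Fintype χ] [MeasurableSpace χ]
    {ν : Measure (ℕ → χ)} {p : χ → ℝ} {P : Matrix χ χ ℝ} (hν : IsMarkovMeasure ν p P)
    (n : ℕ) (w : Fin (n + 1) → χ) :
    (ν {z | ∀ i : Fin (n + 1), z (i : ℕ) = w i}).toReal
      = p (w 0) * ∏ i : Fin n, P (w i.castSucc) (w i.succ) := by
  have hset : {z : ℕ → χ | ∀ i : Fin (n + 1), z (i : ℕ) = w i}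
      = {z | ∀ i ≤ n, z i = w (Fin.ofNat (n + 1) i)} := by
    ext z
    refine ⟨fun hz i hi => ?_, fun hz i => ?_⟩
    · have := hz (Fin.ofNat (n + 1) i)
      rwa [Fin.val_ofNat, Nat.mod_eq_of_lt (Nat.lt_succ_of_le hi)] at this
    · rw [hz i (Nat.le_of_lt_succ i.isLt)]
      simp
  rw [hset, hν n fun i => w (Fin.ofNat (n + 1) i), Finset.prod_range]
  congr 1
  refine Finset.prod_congr rfl fun i _ => ?_
  congr 2 <;> ext <;> simp

/-- Comparable initial distributions give comparable sums of squared cylinder masses. -/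
theorem renyiSum_le_of_initial_le {χ : Type*} [Fintype χ] [MeasurableSpace χ]
    {μ ν : Measure (ℕ → χ)} {p q : χ → ℝ} {P : Matrix χ χ ℝ} (hPnn : ∀ i j, 0 ≤ P i j)
    (hμ : IsMarkovMeasure μ p P) (hν : IsMarkovMeasure ν q P) {C : ℝ}
    (hC : ∀ i, q i ≤ C * p i) (n : ℕ) :
    renyiSum ν (n + 1) ≤ C ^ 2 * renyiSum μ (n + 1) := by
  unfold renyiSum
  rw [Finset.mul_sum]
  refine Finset.sum_le_sum fun w _ => ?_
  rw [← mul_pow]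
  refine pow_le_pow_left₀ ENNReal.toReal_nonneg ?_ 2
  rw [hν.toReal_cylinder, hμ.toReal_cylinder, ← mul_assoc]
  exact mul_le_mul_of_nonneg_right (hC _) (Finset.prod_nonneg fun i _ => hPnn _ _)

theorem one_le_card_pow_mul_renyiSum {χ : Type*} [Fintype χ] [MeasurableSpace χ]
    (Q : Measure (ℕ → χ)) [IsProbabilityMeasure Q] (k : ℕ) :
    1 ≤ (Fintype.card χ : ℝ) ^ k * renyiSum Q k := by
  classical
  have hsum : 1 ≤ ∑ w : Fin k → χ, (Q {z | ∀ i : Fin k, z (i : ℕ) = w i}).toReal := by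
    have hcover : (⋃ w : Fin k → χ, {z : ℕ → χ | ∀ i : Fin k, z (i : ℕ) = w i}) = Set.univ :=
      Set.eq_univ_of_forall fun z => Set.mem_iUnion.2 ⟨fun i => z i, fun _ => rfl⟩
    have hle := measure_iUnion_fintype_le Q
      fun w : Fin k → χ => {z : ℕ → χ | ∀ i : Fin k, z (i : ℕ) = w i}
    rw [hcover, measure_univ] at hle
    rw [← ENNReal.toReal_sum fun w _ => measure_ne_top Q _, ← ENNReal.toReal_one]
    exact ENNReal.toReal_mono (ENNReal.sum_ne_top.2 fun w _ => measure_ne_top Q _) hle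
  have hcs := sq_sum_le_card_mul_sum_sq (s := (Finset.univ : Finset (Fin k → χ)))
    (f := fun w => (Q {z | ∀ i : Fin k, z (i : ℕ) = w i}).toReal)
  rw [Finset.card_univ, Fintype.card_fun, Fintype.card_fin, Nat.cast_pow] at hcs
  exact (one_le_pow₀ hsum).trans hcs

theorem renyiSum_pos {χ : Type*} [Fintype χ] [MeasurableSpace χ]
    (Q : Measure (ℕ → χ)) [IsProbabilityMeasure Q] (k : ℕ) : 0 < renyiSum Q k :=
  pos_of_mul_pos_right (zero_lt_one.trans_le (one_le_card_pow_mul_renyiSum Q k)) (by positivity)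

theorem neg_log_card_le_log_renyiSum {χ : Type*} [Fintype χ] [Nonempty χ] [MeasurableSpace χ]
    (Q : Measure (ℕ → χ)) [IsProbabilityMeasure Q] {k : ℕ} (hk : 0 < k) :
    -Real.log (Fintype.card χ) ≤ (1 / (k : ℝ)) * Real.log (renyiSum Q k) := by
  have hcard : (Fintype.card χ : ℝ) ^ k ≠ 0 := by positivity
  have hlog := Real.log_nonneg (one_le_card_pow_mul_renyiSum Q k)
  rw [Real.log_mul hcard (renyiSum_pos Q k).ne', Real.log_pow] at hlog
  have hk' : (0 : ℝ) < k := by exact_mod_cast hk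
  rw [one_div_mul_eq_div, le_div_iff₀ hk']
  linarith

/-- if the Rényi entropy of the stationary Markov measure `μ` exists and
equals `h` (i.e. `(1/k) log ∑_{C_k} μ(C_k)² → -h`), then for any Markov measure `ν` with the
same (irreducible, aperiodic) transition matrix, `H̲₂(ν) ≥ h`. -/
theorem renyi_entropy_markov_lower_ge
    {χ : Type*} [Fintype χ] [DecidableEq χ] [Nonempty χ] [MeasurableSpace χ]
    (P : Matrix χ χ ℝ) (hPnn : ∀ i j, 0 ≤ P i j) (hProw : ∀ i, ∑ j, P i j = 1)
    (hprim : ∃ n : ℕ, 0 < n ∧ ∀ i j, 0 < (P ^ n) i j)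
    (πμ : χ → ℝ) (hπμnn : ∀ i, 0 ≤ πμ i) (hπμsum : ∑ i, πμ i = 1)
    (hstat : ∀ j, ∑ i, πμ i * P i j = πμ j)
    (π : χ → ℝ) (hπnn : ∀ i, 0 ≤ π i) (hπsum : ∑ i, π i = 1)
    (μ ν : Measure (ℕ → χ)) [IsProbabilityMeasure μ] [IsProbabilityMeasure ν]
    (hμ : IsMarkovMeasure μ πμ P) (hν : IsMarkovMeasure ν π P)
    (h : ℝ)
    (hH2 : Filter.Tendsto (fun k : ℕ => (1 / (k : ℝ)) * Real.log (renyiSum μ k))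
      Filter.atTop (nhds (-h))) :
    h ≤ lowerRenyi ν := by
  have hpos := stationary_pos_of_primitive hprim hπμnn hπμsum hstat
  obtain ⟨i₀, hi₀⟩ := Finite.exists_min πμ
  have hdom : ∀ i, π i ≤ (πμ i₀)⁻¹ * πμ i := fun i =>
    calc π i ≤ 1 := hπsum ▸ Finset.single_le_sum (fun j _ => hπnn j) (Finset.mem_univ i)
      _ = (πμ i₀)⁻¹ * πμ i₀ := (inv_mul_cancel₀ (hpos i₀).ne').symm
      _ ≤ (πμ i₀)⁻¹ * πμ i :=
        mul_le_mul_of_nonneg_left (hi₀ i) (inv_nonneg.2 (hpos i₀).le)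
  have hC : ((πμ i₀)⁻¹) ^ 2 ≠ 0 := pow_ne_zero 2 (inv_ne_zero (hpos i₀).ne')
  have hlim : Tendsto (fun k : ℕ => (1 / (k : ℝ)) * Real.log (((πμ i₀)⁻¹) ^ 2)
      + (1 / (k : ℝ)) * Real.log (renyiSum μ k)) atTop (nhds (-h)) := by
    have hconst := (tendsto_one_div_atTop_nhds_zero_nat (𝕜 := ℝ)).mul_const
      (Real.log (((πμ i₀)⁻¹) ^ 2))
    rw [zero_mul] at hconst
    simpa only [zero_add] using hconst.add hH2
  have hle : (fun k : ℕ => (1 / (k : ℝ)) * Real.log (renyiSum ν k)) ≤ᶠ[atTop]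
      fun k : ℕ => (1 / (k : ℝ)) * Real.log (((πμ i₀)⁻¹) ^ 2)
        + (1 / (k : ℝ)) * Real.log (renyiSum μ k) := by
    filter_upwards [eventually_gt_atTop 0] with k hk
    obtain ⟨n, rfl⟩ := Nat.exists_eq_add_one.2 hk
    rw [← mul_add, ← Real.log_mul hC (renyiSum_pos μ _).ne']
    gcongr
    · exact renyiSum_pos ν _
    · exact renyiSum_le_of_initial_le hPnn hμ hν hdom n
  have hbdd : IsBoundedUnder (· ≥ ·) atTop
      fun k : ℕ => (1 / (k : ℝ)) * Real.log (renyiSum ν k) :=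
    isBoundedUnder_of_eventually_ge
      ((eventually_gt_atTop 0).mono fun _ hk => neg_log_card_le_log_renyiSum ν hk)
  have hliminf := liminf_le_liminf hle hbdd hlim.isCoboundedUnder_ge
  rw [hlim.liminf_eq] at hliminf
  exact le_neg_of_le_neg hliminf
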